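/- Let L : ℝⁿ × ℝᵐ → ℝ be twice continuously differentiable, l-Lipschitz (‖∇L(z)‖ ≤ l for all z), and ε-weakly convex–weakly concave with 0 < ε < η. Then for every z ∈ ℝⁿ × ℝᵐ, the proximal step z₊ = prox_η(z) increases the Lyapunov function ℒ(x,y) = −e_η{−L(x,·)}(y) − e_η{L(·,y)}(x) by at most ℒ(z₊) − ℒ(z) ≤ (εl²/(2η²))·(1 + η/(η−ε)). -/

import Mathlib

open Filter Topology Metric
open scoped RealInnerProductSpace

noncomputable section

abbrev Eu (n : ℕ) : Type := EuclideanSpace ℝ (Fin n)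

noncomputable def gradx {n m : ℕ} (L : Eu n × Eu m → ℝ) (z : Eu n × Eu m) : Eu n :=
  gradient (fun u => L (u, z.2)) z.1

noncomputable def grady {n m : ℕ} (L : Eu n × Eu m → ℝ) (z : Eu n × Eu m) : Eu m :=
  gradient (fun v => L (z.1, v)) z.2

noncomputable def Hxx {n m : ℕ} (L : Eu n × Eu m → ℝ) (z : Eu n × Eu m) : Eu n →L[ℝ] Eu n :=
  fderiv ℝ (fun x => gradient (fun u => L (u, z.2)) x) z.1

noncomputable def Hxy {n m : ℕ} (L : Eu n × Eu m → ℝ) (z : Eu n × Eu m) : Eu m →L[ℝ] Eu n :=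
  fderiv ℝ (fun y => gradient (fun u => L (u, y)) z.1) z.2

noncomputable def Hyx {n m : ℕ} (L : Eu n × Eu m → ℝ) (z : Eu n × Eu m) : Eu n →L[ℝ] Eu m :=
  fderiv ℝ (fun x => gradient (fun v => L (x, v)) z.2) z.1

noncomputable def Hyy {n m : ℕ} (L : Eu n × Eu m → ℝ) (z : Eu n × Eu m) : Eu m →L[ℝ] Eu m :=
  fderiv ℝ (fun y => gradient (fun v => L (z.1, v)) y) z.2

def WeaklyConvexConcave {n m : ℕ} (ρ : ℝ) (L : Eu n × Eu m → ℝ) : Prop :=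
  ∀ z : Eu n × Eu m,
    (∀ v : Eu n, -ρ * ‖v‖ ^ 2 ≤ ⟪(Hxx L z) v, v⟫) ∧
    (∀ w : Eu m, ⟪(Hyy L z) w, w⟫ ≤ ρ * ‖w‖ ^ 2)

def IntDomX {n m : ℕ} (η α : ℝ) (L : Eu n × Eu m → ℝ) : Prop :=
  ∀ z : Eu n × Eu m, ∀ v : Eu n,
    α * ‖v‖ ^ 2 ≤
      ⟪(Hxx L z) v +
        (Hxy L z) ((Ring.inverse (η • (1 : Eu m →L[ℝ] Eu m) - Hyy L z)) ((Hyx L z) v)), v⟫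

def IntDomY {n m : ℕ} (η α : ℝ) (L : Eu n × Eu m → ℝ) : Prop :=
  ∀ z : Eu n × Eu m, ∀ w : Eu m,
    α * ‖w‖ ^ 2 ≤
      ⟪-((Hyy L z) w) +
        (Hyx L z) ((Ring.inverse (η • (1 : Eu n →L[ℝ] Eu n) + Hxx L z)) ((Hxy L z) w)), w⟫

noncomputable def proxObj {n m : ℕ} (η : ℝ) (L : Eu n × Eu m → ℝ) (z w : Eu n × Eu m) : ℝ :=
  L w + η / 2 * ‖w.1 - z.1‖ ^ 2 - η / 2 * ‖w.2 - z.2‖ ^ 2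

def IsProxPoint {n m : ℕ} (η : ℝ) (L : Eu n × Eu m → ℝ) (z w : Eu n × Eu m) : Prop :=
  (∀ v : Eu m, proxObj η L z (w.1, v) ≤ proxObj η L z w) ∧
  (∀ u : Eu n, proxObj η L z w ≤ proxObj η L z (u, w.2))

noncomputable def saddleEnv {n m : ℕ} (η : ℝ) (L : Eu n × Eu m → ℝ)
    (prox : Eu n × Eu m → Eu n × Eu m) (z : Eu n × Eu m) : ℝ :=
  proxObj η L z (prox z)

noncomputable def moreau {n : ℕ} (η : ℝ) (f : Eu n → ℝ) (x : Eu n) : ℝ :=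
  ⨅ u : Eu n, (f u + η / 2 * ‖u - x‖ ^ 2)

noncomputable def lyap {n m : ℕ} (η : ℝ) (L : Eu n × Eu m → ℝ) (z : Eu n × Eu m) : ℝ :=
  -(moreau η (fun v => -L (z.1, v)) z.2) - moreau η (fun u => L (u, z.2)) z.1

noncomputable def hessForm {n m : ℕ} (L : Eu n × Eu m → ℝ) (z v w : Eu n × Eu m) : ℝ :=
  ⟪(Hxx L z) v.1, w.1⟫ + ⟪(Hxy L z) v.2, w.1⟫ + ⟪(Hyx L z) v.1, w.2⟫ + ⟪(Hyy L z) v.2, w.2⟫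

section MoreauEnvelope

variable {n : ℕ} {f : Eu n → ℝ} {ε η : ℝ}

lemma hasGradientAt_of_contDiff_two (hf : ContDiff ℝ 2 f) (x : Eu n) :
    HasGradientAt f (gradient f x) x :=
  ((hf.differentiable (by norm_num)) x).hasGradientAt

lemma differentiable_gradient_of_contDiff_two (hf : ContDiff ℝ 2 f) :
    Differentiable ℝ (gradient f) := by
  have h : Differentiable ℝ (fderiv ℝ f) :=
    (hf.fderiv_right (m := 1) (by norm_num)).differentiable (by norm_num)
  exact (InnerProductSpace.toDual ℝ (Eu n)).symm.toContinuousLinearEquiv.differentiable.comp h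

/-- A lower bound on the Hessian gives a quadratic lower model of the function. -/
lemma quadratic_lower_bound (hf : ContDiff ℝ 2 f)
    (hH : ∀ x v : Eu n, -ε * ‖v‖ ^ 2 ≤ ⟪fderiv ℝ (gradient f) x v, v⟫) (x u : Eu n) :
    f x + ⟪gradient f x, u - x⟫ - ε / 2 * ‖u - x‖ ^ 2 ≤ f u := by
  set d := u - x with hd
  have hline (t : ℝ) : HasDerivAt (fun t : ℝ => x + t • d) d t := by
    simpa using ((hasDerivAt_id t).smul_const d).const_add x
  have hφ (t : ℝ) : HasDerivAt (fun t : ℝ => f (x + t • d) + ε / 2 * t ^ 2 * ‖d‖ ^ 2)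
      (⟪gradient f (x + t • d), d⟫ + ε * t * ‖d‖ ^ 2) t := by
    have h1 := (hasGradientAt_of_contDiff_two hf (x + t • d)).hasFDerivAt.comp_hasDerivAt t
      (hline t)
    have h2 := (((hasDerivAt_id t).pow 2).const_mul (ε / 2)).mul_const (‖d‖ ^ 2)
    refine (h1.add h2).congr_deriv ?_
    simp only [InnerProductSpace.toDual_apply_apply, id, Nat.cast_ofNat]
    ring
  have hψ (t : ℝ) : HasDerivAt (fun t : ℝ => ⟪gradient f (x + t • d), d⟫ + ε * t * ‖d‖ ^ 2)
      (⟪fderiv ℝ (gradient f) (x + t • d) d, d⟫ + ε * ‖d‖ ^ 2) t := by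
    have h1 := (differentiable_gradient_of_contDiff_two hf
      (x + t • d)).hasFDerivAt.comp_hasDerivAt t (hline t)
    have h2 := ((hasDerivAt_id t).const_mul ε).mul_const (‖d‖ ^ 2)
    refine ((h1.inner ℝ (hasDerivAt_const t d)).add h2).congr_deriv ?_
    simp
  have hmono : Monotone (fun t : ℝ => ⟪gradient f (x + t • d), d⟫ + ε * t * ‖d‖ ^ 2) := by
    refine monotone_of_deriv_nonneg (fun t => (hψ t).differentiableAt) fun t => ?_
    rw [(hψ t).deriv]
    linarith [hH (x + t • d) d]
  obtain ⟨c, hc, hc'⟩ := exists_hasDerivAt_eq_slope _ _ zero_lt_one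
    (fun t _ => (hφ t).continuousAt.continuousWithinAt) (fun t _ => hφ t)
  have h0 := hmono hc.1.le
  simp only [hc'] at h0
  have hu : x + d = u := by simp [hd]
  simp only [zero_smul, one_smul, add_zero, hu, mul_zero, zero_mul] at h0
  linarith

lemma quadratic_model_lower_bound (hf : ContDiff ℝ 2 f)
    (hH : ∀ x v : Eu n, -ε * ‖v‖ ^ 2 ≤ ⟪fderiv ℝ (gradient f) x v, v⟫) (hεη : ε < η)
    (x u : Eu n) :
    f x - ‖gradient f x‖ ^ 2 / (2 * (η - ε)) ≤ f u + η / 2 * ‖u - x‖ ^ 2 := by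
  have h := quadratic_lower_bound hf hH x u
  have hc : 0 < η - ε := sub_pos.2 hεη
  have hi := neg_le_of_abs_le (abs_real_inner_le_norm (gradient f x) (u - x))
  set a := ‖gradient f x‖
  set b := ‖u - x‖
  have key : a * b ≤ a ^ 2 / (2 * (η - ε)) + (η - ε) / 2 * b ^ 2 := by
    have : a ^ 2 / (2 * (η - ε)) + (η - ε) / 2 * b ^ 2 - a * b
        = (a - (η - ε) * b) ^ 2 / (2 * (η - ε)) := by
      field_simp
      ring
    have : 0 ≤ (a - (η - ε) * b) ^ 2 / (2 * (η - ε)) := by positivity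
    linarith
  linarith

lemma le_moreau (hf : ContDiff ℝ 2 f)
    (hH : ∀ x v : Eu n, -ε * ‖v‖ ^ 2 ≤ ⟪fderiv ℝ (gradient f) x v, v⟫) (hεη : ε < η)
    (x : Eu n) :
    f x - ‖gradient f x‖ ^ 2 / (2 * (η - ε)) ≤ moreau η f x :=
  le_ciInf (quadratic_model_lower_bound hf hH hεη x)

lemma moreau_le (hf : ContDiff ℝ 2 f)
    (hH : ∀ x v : Eu n, -ε * ‖v‖ ^ 2 ≤ ⟪fderiv ℝ (gradient f) x v, v⟫) (hεη : ε < η)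
    (x u : Eu n) :
    moreau η f x ≤ f u + η / 2 * ‖u - x‖ ^ 2 :=
  ciInf_le ⟨_, Set.forall_mem_range.2 (quadratic_model_lower_bound hf hH hεη x)⟩ u

lemma gradient_eq_of_forall_le (hf : ContDiff ℝ 2 f) {x p : Eu n}
    (hp : ∀ u, f p + η / 2 * ‖p - x‖ ^ 2 ≤ f u + η / 2 * ‖u - x‖ ^ 2) :
    gradient f p = η • (x - p) := by
  have h1 := (hasGradientAt_of_contDiff_two hf p).hasFDerivAt
  have h2 := (((hasFDerivAt_id (𝕜 := ℝ) p).sub_const x).norm_sq).const_mul (η / 2)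
  have hmin : IsLocalMin (fun u => f u + η / 2 * ‖u - x‖ ^ 2) p := Eventually.of_forall hp
  have h0 := hmin.hasFDerivAt_eq_zero (h1.add h2)
  refine ext_inner_right ℝ fun v => ?_
  have hv : ⟪gradient f p, v⟫ + η / 2 * (2 * ⟪p - x, v⟫) = 0 := by
    simpa [inner_sub_left] using DFunLike.congr_fun h0 v
  rw [real_inner_smul_left, ← neg_sub p x, inner_neg_left]
  linarith

lemma add_le_of_forall_le (hf : ContDiff ℝ 2 f)
    (hH : ∀ x v : Eu n, -ε * ‖v‖ ^ 2 ≤ ⟪fderiv ℝ (gradient f) x v, v⟫) {x p : Eu n}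
    (hp : ∀ u, f p + η / 2 * ‖p - x‖ ^ 2 ≤ f u + η / 2 * ‖u - x‖ ^ 2) :
    f p + (η - ε / 2) * ‖p - x‖ ^ 2 ≤ f x := by
  have h := quadratic_lower_bound hf hH p x
  rw [gradient_eq_of_forall_le hf hp, real_inner_smul_left, real_inner_self_eq_norm_sq,
    norm_sub_rev] at h
  linarith

end MoreauEnvelope

lemma gradient_fun_neg {n : ℕ} (f : Eu n → ℝ) :
    gradient (fun v => -f v) = fun v => -gradient f v := by
  funext v
  simp [gradient, fderiv_fun_neg]

/-- for an l-Lipschitz, ε-weakly convex–weakly concave objective,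
a proximal step increases the Lyapunov function by at most
(εl²/(2η²))(1 + η/(η−ε)). -/
theorem statement19 {n m : ℕ}
    (L : Eu n × Eu m → ℝ) (ε η l : ℝ)
    (hL : ContDiff ℝ 2 L)
    (hlip : ∀ z : Eu n × Eu m,
      Real.sqrt (‖gradx L z‖ ^ 2 + ‖grady L z‖ ^ 2) ≤ l)
    (hweak : WeaklyConvexConcave ε L)
    (hε : 0 < ε) (hεη : ε < η)
    (prox : Eu n × Eu m → Eu n × Eu m)
    (hprox : ∀ z, IsProxPoint η L z (prox z))
    (hprox_uniq : ∀ z w, IsProxPoint η L z w → w = prox z) :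
    ∀ z : Eu n × Eu m,
      lyap η L (prox z) - lyap η L z ≤
        ε * l ^ 2 / (2 * η ^ 2) * (1 + η / (η - ε)) := by
  intro z
  set p := prox z
  have hx (y : Eu m) : ContDiff ℝ 2 (fun u => L (u, y)) :=
    hL.comp (contDiff_id.prodMk contDiff_const)
  have hy (x : Eu n) : ContDiff ℝ 2 (fun v => -L (x, v)) :=
    (hL.comp (contDiff_const.prodMk contDiff_id)).neg
  have hHx (y : Eu m) (x v : Eu n) :
      -ε * ‖v‖ ^ 2 ≤ ⟪fderiv ℝ (gradient fun u => L (u, y)) x v, v⟫ := (hweak (x, y)).1 v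
  have hHy (x : Eu n) (y w : Eu m) :
      -ε * ‖w‖ ^ 2 ≤ ⟪fderiv ℝ (gradient fun v => -L (x, v)) y w, w⟫ := by
    have h : ⟪fderiv ℝ (gradient fun v => L (x, v)) y w, w⟫ ≤ ε * ‖w‖ ^ 2 := (hweak (x, y)).2 w
    rw [gradient_fun_neg, fderiv_fun_neg, neg_apply, inner_neg_left]
    linarith
  have hpx (u : Eu n) : L (p.1, p.2) + η / 2 * ‖p.1 - z.1‖ ^ 2
      ≤ L (u, p.2) + η / 2 * ‖u - z.1‖ ^ 2 := by
    have := (hprox z).2 u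
    simp only [proxObj] at this
    linarith
  have hpy (v : Eu m) : -L (p.1, p.2) + η / 2 * ‖p.2 - z.2‖ ^ 2
      ≤ -L (p.1, v) + η / 2 * ‖v - z.2‖ ^ 2 := by
    have := (hprox z).1 v
    simp only [proxObj] at this
    linarith
  have hgx := gradient_eq_of_forall_le (hx p.2) hpx
  have hgy := gradient_eq_of_forall_le (hy p.1) hpy
  have hnx : ‖gradient (fun u => L (u, p.2)) p.1‖ ^ 2 = η ^ 2 * ‖p.1 - z.1‖ ^ 2 := by
    rw [hgx, norm_smul, mul_pow, norm_sub_rev, Real.norm_eq_abs, sq_abs]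
  have hny : ‖gradient (fun v => -L (p.1, v)) p.2‖ ^ 2 = η ^ 2 * ‖p.2 - z.2‖ ^ 2 := by
    rw [hgy, norm_smul, mul_pow, norm_sub_rev, Real.norm_eq_abs, sq_abs]
  have hlow_x := le_moreau (hx p.2) (hHx p.2) hεη p.1
  have hlow_y := le_moreau (hy p.1) (hHy p.1) hεη p.2
  have hup_x := moreau_le (hx z.2) (hHx z.2) hεη z.1 p.1
  have hup_y := moreau_le (hy z.1) (hHy z.1) hεη z.2 p.2
  have hstep_x := add_le_of_forall_le (hx p.2) (hHx p.2) hpx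
  have hstep_y := add_le_of_forall_le (hy p.1) (hHy p.1) hpy
  have hbound : η ^ 2 * (‖p.1 - z.1‖ ^ 2 + ‖p.2 - z.2‖ ^ 2) ≤ l ^ 2 := by
    have h := (Real.sqrt_le_iff.1 (hlip p)).2
    have hx' : ‖gradx L p‖ ^ 2 = η ^ 2 * ‖p.1 - z.1‖ ^ 2 := hnx
    have hy' : ‖grady L p‖ ^ 2 = η ^ 2 * ‖p.2 - z.2‖ ^ 2 := by
      rw [← hny, gradient_fun_neg, norm_neg]
      rfl
    rw [hx', hy'] at h
    linarith
  rw [hnx] at hlow_x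
  rw [hny] at hlow_y
  have hη : 0 < η := hε.trans hεη
  have hc : 0 < η - ε := sub_pos.2 hεη
  set D := ‖p.1 - z.1‖ ^ 2 + ‖p.2 - z.2‖ ^ 2 with hD
  have hdiff : lyap η L p - lyap η L z ≤ η ^ 2 * D / (2 * (η - ε)) - (η - ε) / 2 * D := by
    have hsplit : η ^ 2 * D / (2 * (η - ε)) = η ^ 2 * ‖p.1 - z.1‖ ^ 2 / (2 * (η - ε))
        + η ^ 2 * ‖p.2 - z.2‖ ^ 2 / (2 * (η - ε)) := by
      rw [← add_div, hD, mul_add]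
    simp only [lyap]
    rw [hsplit, hD]
    linarith
  have heq : η ^ 2 * D / (2 * (η - ε)) - (η - ε) / 2 * D
      = ε * (η ^ 2 * D) / (2 * η ^ 2) * (1 + η / (η - ε)) := by
    field_simp
    ring
  rw [heq] at hdiff
  refine hdiff.trans ?_
  gcongr

end
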